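/- arXiv:1504.01719 — 2 statements merged into one kernel-verified Lean document; each statement's English description precedes it below -/
import Mathlib

section
/- Let n ≥ 1. A finite sequence F = (w_1,…,w_k) of nonempty words on positive integers whose lengths sum to n is the LR-decomposition F_a of some parking function a of length n if and only if: (1) the concatenated word w_k ⋯ w_2 w_1 is a parking function; (2) each word w_i is dominated (its first letter equals its minimal letter); and (3) min(w_1) < min(w_2) < ⋯ < min(w_k). Moreover, the map a ↦ F_a is a bijection from P_n onto the set of all such sequences. -/
open scoped Classical

/-- Words on natural numbers (letters are intended to be positive integers). -/
abbrev W : Type := List ℕ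

/-- `IsPF a` : the word `a` is a parking function, i.e. all its letters are
positive and its nondecreasing rearrangement `b₁ b₂ ⋯ bₙ` satisfies `bᵢ ≤ i`. -/
def IsPF (a : W) : Prop :=
  (∀ x ∈ a, 1 ≤ x) ∧
    ∀ i, i < a.length → (a.insertionSort (· ≤ ·)).getD i 0 ≤ i + 1

/-- Split a word into the consecutive segments beginning at its
left-to-right minima (in the order in which they occur in the word). -/
def segs : W → List W
  | [] => []
  | x :: xs =>
      (x :: xs.takeWhile fun y => x ≤ y) :: segs (xs.dropWhile fun y => x ≤ y)
termination_by a => a.length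
decreasing_by
  simpa using Nat.lt_succ_of_le (List.dropWhile_sublist _).length_le

/-- The LR-decomposition `F_a` of a word `a`: the sequence of segments beginning
at the left-to-right minima, listed in increasing order of their minimal letters
(i.e. in reverse order of occurrence in `a`). -/
def LR (a : W) : List W := (segs a).reverse

/-- The word `w_k ⋯ w_2 w_1` encoded by an LR-decomposition `(w_1, …, w_k)`. -/
def wordOf (F : List W) : W := F.reverse.flatten

/-- A word is dominated if it is nonempty and its first letter is its minimal letter. -/
def Dominated (w : W) : Prop := w ≠ [] ∧ ∀ x ∈ w, w.headD 0 ≤ x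

/-- The minimal letter of a word (`0` for the empty word). -/
def minW (w : W) : ℕ := (w.min?).getD 0

/-- Add `m` to every letter of a word. -/
def shiftW (m : ℕ) (w : W) : W := w.map (· + m)

/-- Add `m` to every letter of every word of a sequence of words. -/
def shiftF (m : ℕ) (F : List W) : List W := F.map (shiftW m)

/-- The word whose LR-decomposition is the finite set of words `G`:
sort `G` increasingly (for dominated words with distinct minimal letters the
lexicographic order agrees with comparing the minimal letters) and concatenate
in decreasing order. -/
noncomputable def wordOfSet (G : Finset W) : W := (G.sort (· ≤ ·)).reverse.flatten

/-- Given vertex sets `X`, `Y` (of words) and a set `Θ` of edges, the resulting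
set of words: concatenations `u ++ w` over edges `(u, w) ∈ Θ`, together with all
unmatched words of `X` and of `Y`. -/
noncomputable def glueSet (X Y : Finset W) (Θ : Finset (W × W)) : Finset W :=
  Θ.image (fun p => p.1 ++ p.2) ∪
    X.filter (fun u => ∀ p ∈ Θ, p.1 ≠ u) ∪
    Y.filter (fun w => ∀ p ∈ Θ, p.2 ≠ w)

/-- `R(a,b)` : the set of matchings between `F_a` and `F_b + m` (`m` the length
of `a`), encoded as sets of edges in which no vertex occurs twice. -/
noncomputable def Rset (a b : W) : Finset (Finset (W × W)) :=
  ((LR a).toFinset ×ˢ (shiftF a.length (LR b)).toFinset).powerset.filter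
    (fun Θ => ∀ p ∈ Θ, ∀ q ∈ Θ, (p.1 = q.1 ∨ p.2 = q.2) → p = q)

/-- `aΘb` : the parking function whose LR-decomposition consists of the
concatenations `u ⬝ (w + m)` over the edges `(u, w + m)` of `Θ` together with all
unmatched words of `F_a` and of `F_b + m`. -/
noncomputable def mTheta (a b : W) (Θ : Finset (W × W)) : W :=
  wordOfSet (glueSet (LR a).toFinset (shiftF a.length (LR b)).toFinset Θ)

/-- `d(a) = min { i : #{ j : a_j ≤ i } < i }`. -/
def dVal (a : W) : ℕ :=
  Nat.find (p := fun i => (a.filter (fun x => x ≤ i)).length < i)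
    ⟨a.length + 1, Nat.lt_succ_of_le (List.length_filter_le _ _)⟩

/-- One step of the parkization algorithm: decrement every letter greater
than `d(a)`.  (This is the identity when `a` is a parking function.) -/
def parkStep (a : W) : W := a.map fun x => if dVal a < x then x - 1 else x

/-- Auxiliary fueled version of the parkization algorithm. -/
def parkFuel : ℕ → W → W
  | 0, a => a
  | k + 1, a => if dVal a = a.length + 1 then a else parkFuel k (parkStep a)

/-- The parkization `Park a` of a word `a`.  (For a word with positive letters
the algorithm needs at most `a.sum` steps, so the fuel below suffices.) -/
def Park (a : W) : W := parkFuel a.sum a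

/-- The subword of `a` obtained by keeping exactly the words of `F_a`
belonging to `S`. -/
def subWord (a : W) (S : Finset W) : W := wordOf ((LR a).filter (· ∈ S))

/-- The free module with basis indexed by words; the Hopf algebra `PFSym` is
its submodule spanned by `{M_a : a ∈ P}`. -/
abbrev FW (K : Type) [Field K] : Type := W →₀ K

/-- The monomial basis element `M_a`. -/
noncomputable def Mb (K : Type) [Field K] (a : W) : FW K := Finsupp.single a 1

/-- `M_a ⋆ M_b = Σ_{Θ ∈ R(a,b)} M_{aΘb}` on basis elements. -/
noncomputable def mulSingle (K : Type) [Field K] (a b : W) : FW K :=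
  ∑ Θ ∈ Rset a b, Mb K (mTheta a b Θ)

/-- The product `⋆`, extended bilinearly. -/
noncomputable def starF (K : Type) [Field K] (x y : FW K) : FW K :=
  x.sum fun a ca => y.sum fun b cb => (ca * cb) • mulSingle K a b

/-- The free module with basis indexed by pairs of words; it realizes the
tensor square of `FW K` via `M_a ⊗ M_b ↦ single (a,b)`. -/
abbrev FW2 (K : Type) [Field K] : Type := (W × W) →₀ K

/-- `Δ(M_a) = Σ M_{Park a'} ⊗ M_{Park a''}` over ordered pairs `(a', a'')` of
subwords of `a` with `F_{a'} ⊍ F_{a''} = F_a` (encoded by the subset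
`S ⊆ F_a` of words kept in `a'`). -/
noncomputable def deltaSingle (K : Type) [Field K] (a : W) : FW2 K :=
  ∑ S ∈ ((LR a).toFinset).powerset,
    Finsupp.single
      (Park (subWord a S), Park (subWord a (((LR a).toFinset) \ S))) 1

/-- The coproduct `Δ`, extended linearly. -/
noncomputable def deltaF (K : Type) [Field K] (x : FW K) : FW2 K :=
  x.sum fun a ca => ca • deltaSingle K a

/-- The componentwise product on the tensor square, on basis elements:
`(M_a ⊗ M_b) ⋆ (M_c ⊗ M_d) = (M_a ⋆ M_c) ⊗ (M_b ⋆ M_d)`. -/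
noncomputable def star2Single (K : Type) [Field K] (p q : W × W) : FW2 K :=
  ∑ Θ ∈ Rset p.1 q.1, ∑ Θ' ∈ Rset p.2 q.2,
    Finsupp.single (mTheta p.1 q.1 Θ, mTheta p.2 q.2 Θ') 1

/-- The componentwise product on the tensor square, extended bilinearly. -/
noncomputable def star2F (K : Type) [Field K] (x y : FW2 K) : FW2 K :=
  x.sum fun p cp => y.sum fun q cq => (cp * cq) • star2Single K p q

/-- The counit `ε` on basis elements. -/
noncomputable def epsW (K : Type) [Field K] (a : W) : K := if a = [] then 1 else 0

/-- `F_a ∘ F_b` : concatenate the `i`-th words of `F_a` and `F_b + m`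
for `i ≤ min(r,s)` and keep the remaining unpaired words. -/
def splitLR (F G : List W) : List W :=
  List.zipWith (· ++ ·) F G ++ F.drop G.length ++ G.drop F.length

/-- The split product `a ∘ b`. -/
def splitProd (a b : W) : W := wordOf (splitLR (LR a) (shiftF a.length (LR b)))

/-- A nonempty parking function is unsplitable if it is not the split product
of two nonempty parking functions. -/
def UnsplitablePF (a : W) : Prop :=
  IsPF a ∧ a ≠ [] ∧
    ¬ ∃ b c : W, IsPF b ∧ IsPF c ∧ b ≠ [] ∧ c ≠ [] ∧ a = splitProd b c

/-- The slash product `a | b = (b₁+m) ⋯ (bₙ+m) a₁ ⋯ a_m`. -/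
def slashProd (a b : W) : W := shiftW a.length b ++ a

/-- A nonempty parking function is atomic if it is not the slash product
of two nonempty parking functions. -/
def AtomicPF (a : W) : Prop :=
  IsPF a ∧ a ≠ [] ∧
    ¬ ∃ b c : W, IsPF b ∧ IsPF c ∧ b ≠ [] ∧ c ≠ [] ∧ a = slashProd b c

/-- `u ≺* v` : either `v` is a proper initial subword of `u`, or `u` is not a
proper initial subword of `v` and `u` precedes `v` lexicographically. -/
def precStar (u v : W) : Prop :=
  (v <+: u ∧ v ≠ u) ∨ (¬ (u <+: v ∧ u ≠ v) ∧ List.Lex (· < ·) u v)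

/-- `a ≺*_lex b` : `F_a` strictly precedes `F_b` in the lexicographic order
on sequences of words induced by `≺*`. -/
def precStarLex (a b : W) : Prop := List.Lex precStar (LR a) (LR b)

/-- The covering relation of `≤_*` : `b` covers `a` if `F_b` is obtained from
`F_a = (w_1, …, w_r)` by replacing `w_i` by `w_i ⬝ w_j` and removing `w_j`,
for some `i < j` such that every letter of `w_i` is at most every letter of `w_j`. -/
def CovStar (a b : W) : Prop :=
  ∃ i j, i < j ∧ j < (LR a).length ∧
    (∀ x ∈ (LR a).getD i [], ∀ y ∈ (LR a).getD j [], x ≤ y) ∧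
    LR b = ((LR a).set i ((LR a).getD i [] ++ (LR a).getD j [])).eraseIdx j

/-- The partial order `≤_*` on parking functions, generated by the covering
relations. -/
def leStar (a b : W) : Prop := Relation.ReflTransGen CovStar a b

/-- The finite set of all parking functions of length `n`. -/
noncomputable def pfFinset (n : ℕ) : Finset W :=
  ((Finset.univ : Finset (Fin n → Fin n)).image
      (fun f => List.ofFn fun i => (f i).val + 1)).filter IsPF

/-- The basis element `Q_a = Σ_{a ≤_* b} M_b`. -/
noncomputable def Qb (K : Type) [Field K] (a : W) : FW K :=
  ∑ b ∈ (pfFinset a.length).filter (fun b => leStar a b), Mb K b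

/-- `Q_x ⊗ Q_y` as an element of the tensor square. -/
noncomputable def QT (K : Type) [Field K] (x y : W) : FW2 K :=
  ∑ b ∈ (pfFinset x.length).filter (fun b => leStar x b),
    ∑ c ∈ (pfFinset y.length).filter (fun c => leStar y c),
      Finsupp.single (b, c) 1

/-- `a` is a nonincreasing word. -/
def NonInc (a : W) : Prop := a.Chain' (fun x y => y ≤ x)

/-- Every word of the LR-decomposition of `a` is nondecreasing. -/
def Nprop (a : W) : Prop := ∀ w ∈ LR a, w.Chain' (· ≤ ·)

/-- The words of the LR-decomposition of `a` have pairwise disjoint sets of letters. -/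
def Dprop (a : W) : Prop := (LR a).Pairwise (fun u v => ∀ x ∈ u, x ∉ v)

/-- `a` is a permutation of `{1, …, n}` viewed as a word. -/
def Sprop (a : W) : Prop := a.Perm (List.range' 1 a.length)


theorem minW_cons_of_le (x : ℕ) (t : List ℕ) (h : ∀ y ∈ t, x ≤ y) : minW (x :: t) = x := by
  have : (x :: t).min? = some x := by
    rw [List.min?_eq_some_iff]
    refine ⟨by simp, ?_⟩
    intro b hb
    rcases List.mem_cons.1 hb with rfl | hb
    · exact le_rfl
    · exact h b hb
  simp [minW, this]

theorem minW_seg (x : ℕ) (xs : List ℕ) :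
    minW (x :: xs.takeWhile fun y => x ≤ y) = x := by
  apply minW_cons_of_le
  intro y hy
  simpa using List.mem_takeWhile_imp hy

theorem segs_cons (x : ℕ) (xs : List ℕ) : segs (x :: xs) =
    (x :: xs.takeWhile fun y => x ≤ y) :: segs (xs.dropWhile fun y => x ≤ y) := by
  rw [segs]

theorem segs_spec (n : ℕ) : ∀ a : W, a.length ≤ n → (segs a).flatten = a ∧
    (∀ w ∈ segs a, Dominated w) ∧ (segs a).IsChain (fun u v => minW v < minW u) := by
  induction n with
  | zero =>
    intro a ha
    have : a = [] := by simpa using ha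
    subst this
    simp [segs]
  | succ n ih =>
    intro a ha
    cases a with
    | nil => simp [segs]
    | cons x xs =>
      rw [segs_cons]
      have hl : (xs.dropWhile fun y => decide (x ≤ y)).length ≤ n := by
        have h1 := (List.dropWhile_sublist (fun y => decide (x ≤ y)) (l := xs)).length_le
        simp only [List.length_cons] at ha
        omega
      obtain ⟨h1, h2, h3⟩ := ih _ hl
      refine ⟨?_, ?_, ?_⟩
      · rw [List.flatten_cons, h1]
        simp
      · intro w hw
        rcases List.mem_cons.1 hw with rfl | hw
        · refine ⟨by simp, ?_⟩
          intro y hy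
          rcases List.mem_cons.1 hy with rfl | hy
          · simp
          · simpa using List.mem_takeWhile_imp hy
        · exact h2 w hw
      · rw [List.isChain_cons]
        refine ⟨?_, h3⟩
        intro v hv
        rw [minW_seg]
        cases hd : (xs.dropWhile fun y => decide (x ≤ y)) with
        | nil => rw [hd] at hv; simp [segs] at hv
        | cons y ys =>
          rw [hd, segs_cons] at hv
          simp only [List.head?_cons, Option.mem_def, Option.some.injEq] at hv
          subst hv
          rw [minW_seg]
          have := List.head?_dropWhile_not (fun y => decide (x ≤ y)) xs
          rw [hd] at this
          simpa using this

theorem segs_flatten (G : List W) (h : ∀ w ∈ G, Dominated w)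
    (hc : G.IsChain (fun u v => minW v < minW u)) : segs G.flatten = G := by
  induction G with
  | nil => simp [segs]
  | cons w G ih =>
    rw [List.isChain_cons] at hc
    have ih' := ih (fun w hw => h w (by simp [hw])) hc.2
    obtain ⟨hne, hw⟩ := h w (by simp)
    cases w with
    | nil => exact absurd rfl hne
    | cons x t =>
      have hx : ∀ y ∈ t, x ≤ y := fun y hy => by simpa using hw y (by simp [hy])
      rw [List.flatten_cons, List.cons_append, segs_cons]
      have hall : ∀ y ∈ t, decide (x ≤ y) = true := by simpa using hx
      have key : (G.flatten.takeWhile fun y => decide (x ≤ y)) = [] ∧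
          (G.flatten.dropWhile fun y => decide (x ≤ y)) = G.flatten := by
        cases G with
        | nil => simp
        | cons v G =>
          obtain ⟨hvne, hv⟩ := h v (by simp)
          have hlt := hc.1 v (by simp)
          cases v with
          | nil => exact absurd rfl hvne
          | cons z s =>
            rw [minW_cons_of_le x t hx,
              minW_cons_of_le z s (fun y hy => by simpa using hv y (by simp [hy]))] at hlt
            have : ¬ x ≤ z := by omega
            simp [this]
      rw [List.takeWhile_append_of_pos hall, List.dropWhile_append_of_pos hall, key.1, key.2, ih']
      simp

theorem wordOf_LR (a : W) : wordOf (LR a) = a := by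
  simp [wordOf, LR, (segs_spec a.length a le_rfl).1]

theorem length_wordOf (F : List W) : (wordOf F).length = (F.map List.length).sum := by
  simp [wordOf, List.length_flatten, List.sum_reverse]

theorem LR_good (a : W) : (∀ w ∈ LR a, Dominated w) ∧
    (LR a).IsChain (fun u v => minW u < minW v) := by
  obtain ⟨-, h2, h3⟩ := segs_spec a.length a le_rfl
  refine ⟨fun w hw => h2 w (by simpa [LR] using hw), ?_⟩
  rw [LR, List.isChain_reverse]
  exact h3

theorem LR_wordOf (F : List W) (h : ∀ w ∈ F, Dominated w)
    (hc : F.IsChain (fun u v => minW u < minW v)) : LR (wordOf F) = F := by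
  rw [LR, wordOf, segs_flatten, List.reverse_reverse]
  · simpa using h
  · rw [List.isChain_reverse]
    exact hc

/-- For `n ≥ 1`, a finite sequence `F = (w_1, …, w_k)` of nonempty
words whose lengths sum to `n` is the LR-decomposition of some parking function of
length `n` iff (1) the concatenation `w_k ⋯ w_1` is a parking function, (2) each `w_i`
is dominated and (3) the minimal letters are strictly increasing; moreover
`a ↦ F_a` is a bijection from `P_n` onto the set of such sequences. -/
theorem stmt0 (n : ℕ) (hn : 1 ≤ n) :
    (∀ F : List W,
        ((∀ w ∈ F, w ≠ []) ∧ (F.map List.length).sum = n ∧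
          IsPF (wordOf F) ∧ (∀ w ∈ F, Dominated w) ∧
          F.Chain' (fun u v => minW u < minW v))
        ↔ ∃ a : W, IsPF a ∧ a.length = n ∧ LR a = F) ∧
    Set.BijOn LR {a : W | IsPF a ∧ a.length = n}
      {F : List W | (∀ w ∈ F, w ≠ []) ∧ (F.map List.length).sum = n ∧
        IsPF (wordOf F) ∧ (∀ w ∈ F, Dominated w) ∧
        F.Chain' (fun u v => minW u < minW v)} := by
  have fwd : ∀ a : W, IsPF a → a.length = n → ((∀ w ∈ LR a, w ≠ []) ∧
      ((LR a).map List.length).sum = n ∧ IsPF (wordOf (LR a)) ∧ (∀ w ∈ LR a, Dominated w) ∧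
      (LR a).IsChain (fun u v => minW u < minW v)) := by
    intro a ha hl
    obtain ⟨h1, h2⟩ := LR_good a
    refine ⟨fun w hw => (h1 w hw).1, ?_, ?_, h1, h2⟩
    · rw [← length_wordOf, wordOf_LR, hl]
    · rw [wordOf_LR]; exact ha
  have bwd : ∀ F : List W, ((∀ w ∈ F, w ≠ []) ∧ (F.map List.length).sum = n ∧
      IsPF (wordOf F) ∧ (∀ w ∈ F, Dominated w) ∧
      F.IsChain (fun u v => minW u < minW v)) → ∃ a : W, (IsPF a ∧ a.length = n) ∧ LR a = F := by
    rintro F ⟨-, h2, h3, h4, h5⟩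
    exact ⟨wordOf F, ⟨h3, by rw [length_wordOf, h2]⟩, LR_wordOf F h4 h5⟩
  refine ⟨fun F => ⟨fun h => ?_, ?_⟩, ?_, ?_, ?_⟩
  · obtain ⟨a, ⟨h1, h2⟩, h3⟩ := bwd F h
    exact ⟨a, h1, h2, h3⟩
  · rintro ⟨a, h1, h2, rfl⟩
    exact fwd a h1 h2
  · rintro a ⟨h1, h2⟩
    exact fwd a h1 h2
  · intro a _ b _ hab
    rw [← wordOf_LR a, ← wordOf_LR b, hab]
  · intro F hF
    exact bwd F hF
end

section
/- For every word a of length n on positive integers, the parkization algorithm terminates and produces a parking function Park(a) of length n; moreover Park(a) = a if and only if a is a parking function. -/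
open scoped Classical

lemma dVal_eq_iff (a : W) : dVal a = a.length + 1 ↔
    ∀ i, i ≤ a.length → i ≤ (a.filter (fun x => x ≤ i)).length := by
  unfold dVal
  rw [Nat.find_eq_iff]
  constructor
  · rintro ⟨_, h⟩ i hi
    exact not_lt.mp (h i (by omega))
  · intro h
    exact ⟨Nat.lt_succ_of_le (List.length_filter_le _ _),
      fun i hi => not_lt.mpr (h i (by omega))⟩

lemma dVal_spec (a : W) : (a.filter (fun x => x ≤ dVal a)).length < dVal a := by
  have h := Nat.find_spec (p := fun i => (a.filter (fun x => x ≤ i)).length < i)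
    ⟨a.length + 1, Nat.lt_succ_of_le (List.length_filter_le _ _)⟩
  exact h

lemma dVal_le (a : W) : dVal a ≤ a.length + 1 :=
  Nat.find_min' _ (Nat.lt_succ_of_le (List.length_filter_le _ _))

lemma dVal_pos (a : W) : 1 ≤ dVal a := by
  have := dVal_spec a
  omega

lemma sorted_char (b : List ℕ) (hb : b.Pairwise (· ≤ ·)) :
    (∀ i, i < b.length → b.getD i 0 ≤ i + 1) ↔
    ∀ i, i ≤ b.length → i ≤ (b.filter (fun x => x ≤ i)).length := by
  constructor
  · intro h i hi
    have h1 : (b.take i).filter (fun x => x ≤ i) = b.take i := by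
      rw [List.filter_eq_self]
      intro x hx
      obtain ⟨j, hj, rfl⟩ := List.mem_iff_getElem.mp hx
      have hj' : j < i ∧ j < b.length := by simpa using hj
      have := h j hj'.2
      rw [List.getD_eq_getElem _ _ hj'.2] at this
      simp only [List.getElem_take, decide_eq_true_eq]
      omega
    have h2 := ((List.take_sublist i b).filter (fun x => decide (x ≤ i))).length_le
    rw [h1, List.length_take] at h2
    omega
  · intro h i hi
    by_contra hc
    rw [List.getD_eq_getElem _ _ hi] at hc
    have h1 : (b.drop i).filter (fun x => x ≤ i + 1) = [] := by
      rw [List.filter_eq_nil_iff]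
      intro x hx
      obtain ⟨j, hj, rfl⟩ := List.mem_iff_getElem.mp hx
      have hj' : i + j < b.length := by
        rw [List.length_drop] at hj
        omega
      simp only [List.getElem_drop, decide_eq_true_eq]
      rcases Nat.eq_zero_or_pos j with rfl | hp
      · simpa using hc
      · have := List.pairwise_iff_getElem.mp hb i (i + j) hi hj' (by omega)
        omega
    have h2 := h (i + 1) hi
    have h3 : (b.filter (fun x => x ≤ i + 1)).length
        = ((b.take i).filter (fun x => x ≤ i + 1)).length
          + ((b.drop i).filter (fun x => x ≤ i + 1)).length := by
      rw [← List.length_append, ← List.filter_append, List.take_append_drop]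
    have h4 := List.length_filter_le (fun x => decide (x ≤ i + 1)) (b.take i)
    rw [List.length_take] at h4
    rw [h1] at h3
    simp only [List.length_nil] at h3
    omega

lemma isPF_iff (a : W) : IsPF a ↔ (∀ x ∈ a, 1 ≤ x) ∧ dVal a = a.length + 1 := by
  have hp := List.perm_insertionSort (· ≤ ·) a
  have hs := sorted_char (a.insertionSort (· ≤ ·)) (List.pairwise_insertionSort (· ≤ ·) a)
  unfold IsPF
  rw [dVal_eq_iff]
  refine and_congr_right fun _ => ?_
  rw [hp.length_eq] at hs
  refine Iff.trans (by convert Iff.rfl) (hs.trans ?_)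
  refine forall_congr' fun i => ?_
  rw [(hp.filter _).length_eq]

lemma parkStep_fixed (a : W) (h : IsPF a) : parkStep a = a := by
  have hd := ((isPF_iff a).mp h).2
  have h1 := (dVal_eq_iff a).mp hd a.length le_rfl
  have h2 : a.filter (fun x => x ≤ a.length) = a :=
    List.filter_sublist.eq_of_length_le h1
  rw [List.filter_eq_self] at h2
  unfold parkStep
  rw [hd]
  conv_rhs => rw [← List.map_id a]
  refine List.map_congr_left fun x hx => ?_
  have := h2 x hx
  simp only [decide_eq_true_eq] at this
  rw [if_neg (by omega), id]

lemma parkStep_pos (a : W) (ha : ∀ x ∈ a, 1 ≤ x) : ∀ x ∈ parkStep a, 1 ≤ x := by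
  intro x hx
  obtain ⟨y, hy, rfl⟩ := List.mem_map.mp hx
  have := ha y hy
  have := dVal_pos a
  split_ifs <;> omega

lemma parkStep_sum (a : W) (h : dVal a ≠ a.length + 1) : (parkStep a).sum < a.sum := by
  have hle := dVal_le a
  have hs := dVal_spec a
  have hex : ∃ x ∈ a, dVal a < x := by
    by_contra hc
    push Not at hc
    have : a.filter (fun x => x ≤ dVal a) = a := by
      rw [List.filter_eq_self]
      intro x hx
      simpa using hc x hx
    rw [this] at hs
    omega
  have := List.sum_lt_sum (l := a) (fun x => if dVal a < x then x - 1 else x) id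
    (fun x _ => by simp only [id]; split_ifs <;> omega)
    (by
      obtain ⟨x, hx, hlt⟩ := hex
      exact ⟨x, hx, by simp only [id, if_pos hlt]; omega⟩)
  simpa [parkStep] using this

lemma parkFuel_spec (k : ℕ) : ∀ a : W, (∀ x ∈ a, 1 ≤ x) → a.sum ≤ k →
    IsPF (parkFuel k a) ∧ ∃ j, parkStep^[j] a = parkFuel k a := by
  induction k with
  | zero =>
    intro a ha hk
    refine ⟨?_, 0, rfl⟩
    have : a = [] := by
      cases a with
      | nil => rfl
      | cons x l =>
        have := ha x (by simp)
        simp at hk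
        omega
    subst this
    simp [parkFuel, IsPF]
  | succ k ih =>
    intro a ha hk
    unfold parkFuel
    split_ifs with h
    · exact ⟨(isPF_iff a).mpr ⟨ha, h⟩, 0, rfl⟩
    · have hlt := parkStep_sum a h
      obtain ⟨h1, j, hj⟩ := ih (parkStep a) (parkStep_pos a ha) (by omega)
      exact ⟨h1, j + 1, hj⟩

lemma iter_stable (a : W) (j k : ℕ) (hjk : j ≤ k) (h : IsPF (parkStep^[j] a)) :
    parkStep^[k] a = parkStep^[j] a := by
  obtain ⟨m, rfl⟩ := Nat.exists_eq_add_of_le' hjk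
  rw [Function.iterate_add_apply]
  exact Function.iterate_fixed (parkStep_fixed _ h) m

theorem stmt1 (a : W) (ha : ∀ x ∈ a, 1 ≤ x) :
    (∃ k, IsPF (parkStep^[k] a)) ∧
    IsPF (Park a) ∧
    (Park a).length = a.length ∧
    (∀ k, IsPF (parkStep^[k] a) → parkStep^[k] a = Park a) ∧
    (Park a = a ↔ IsPF a) := by
  obtain ⟨h1, j, hj⟩ : IsPF (Park a) ∧ ∃ j, parkStep^[j] a = Park a :=
    parkFuel_spec a.sum a ha le_rfl
  have hu : ∀ k, IsPF (parkStep^[k] a) → parkStep^[k] a = Park a := by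
    intro k hk
    rw [← hj] at h1 ⊢
    rcases le_total j k with h | h
    · exact iter_stable a j k h h1
    · exact (iter_stable a k j h hk).symm
  have hl : ∀ k, (parkStep^[k] a).length = a.length := by
    intro k
    induction k with
    | zero => rfl
    | succ k ih => rw [Function.iterate_succ_apply', parkStep, List.length_map, ih]
  refine ⟨⟨j, hj ▸ h1⟩, h1, hj ▸ hl j, hu, fun h => h ▸ h1, fun h => (hu 0 h).symm⟩
end
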